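/- Let (Γ_a)_{a=0}^{10} be a Majorana representation. Then for every ψ ∈ ℝ³² and all indices b, b₁, b₂, b₃, b₄ ∈ {0,…,10} the following quartic Fierz identities hold (all repeated indices summed over {0,…,10}): (i) Σ_a (ψ̄ Γ_{ab} ψ)(ψ̄ Γ^a ψ) = 0; (ii) Σ_a (ψ̄ Γ_{a b₁b₂b₃b₄} ψ)(ψ̄ Γ^a ψ) = (3/4!) Σ_{σ∈S₄} sgn(σ) (ψ̄ Γ_{b_{σ(1)} b_{σ(2)}} ψ)(ψ̄ Γ_{b_{σ(3)} b_{σ(4)}} ψ); (iii) Σ_a (ψ̄ Γ_{a b₁b₂b₃b₄} ψ)(ψ̄ Γ^a ψ) = −(1/6) Σ_{a₁,a₂} (ψ̄ Γ^{a₁a₂} ψ)(ψ̄ Γ_{a₁a₂ b₁b₂b₃b₄} ψ). -/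

import Mathlib

open Matrix BigOperators

noncomputable section

/-- The 11×11 Minkowski metric `η = diag(−1,+1,…,+1)`. -/
def eta (a b : Fin 11) : ℝ :=
  if a = b then (if a = 0 then -1 else 1) else 0

/-- The 11d Clifford relations `Γ_a Γ_b + Γ_b Γ_a = 2 η_{ab} · 1`. -/
def CliffordRel {A : Type*} [Ring A] [Algebra ℝ A] (Γ : Fin 11 → A) : Prop :=
  ∀ a b : Fin 11, Γ a * Γ b + Γ b * Γ a = (2 * eta a b) • (1 : A)

/-- The antisymmetrized Clifford element
`Γ_{a₁⋯a_p} = (1/p!) Σ_{σ ∈ S_p} sgn(σ) Γ_{a_{σ(1)}} ⋯ Γ_{a_{σ(p)}}`. -/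
def gammaA {A : Type*} [Ring A] [Algebra ℝ A] (Γ : Fin 11 → A) (p : ℕ)
    (a : Fin p → Fin 11) : A :=
  (p.factorial : ℝ)⁻¹ • ∑ σ : Equiv.Perm (Fin p),
    ((Equiv.Perm.sign σ : ℤ) : ℝ) • (List.ofFn fun i => Γ (a (σ i))).prod

/-- The Levi-Civita symbol (lower indices): the sign of `(a₁,…,a₁₁)` as a permutation
of `(0,…,10)`, and `0` if two indices coincide; in particular `ε_{0 1 ⋯ 10} = +1`. -/
def epsL (a : Fin 11 → Fin 11) : ℝ :=
  ∑ σ : Equiv.Perm (Fin 11),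
    if (∀ i, a i = σ i) then ((Equiv.Perm.sign σ : ℤ) : ℝ) else 0
/-- A Majorana representation: real 32×32 matrices satisfying the 11d Clifford relations
`Γ_a Γ_b + Γ_b Γ_a = 2 η_{ab} · Id`, the volume normalization `Γ₀ Γ₁ ⋯ Γ₁₀ = Id`,
and the symmetry condition `Γ_aᵀ = Γ₀ Γ_a Γ₀`. -/
def Majorana (Γ : Fin 11 → Matrix (Fin 32) (Fin 32) ℝ) : Prop :=
  CliffordRel Γ ∧ (List.ofFn Γ).prod = 1 ∧ ∀ a, (Γ a)ᵀ = Γ 0 * Γ a * Γ 0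

/-- The Majorana spinor pairing `(ψ̄ M φ) := ψᵀ Γ₀ M φ`; for `M = 1` this is `(ψ̄ φ)`. -/
def pair (Γ : Fin 11 → Matrix (Fin 32) (Fin 32) ℝ) (M : Matrix (Fin 32) (Fin 32) ℝ)
    (ψ φ : Fin 32 → ℝ) : ℝ :=
  ψ ⬝ᵥ (Γ 0 * M).mulVec φ

/-- The index-raised antisymmetrized Clifford element
`Γ^{a₁⋯a_p} = Σ_b η^{a₁b₁} ⋯ η^{a_pb_p} Γ_{b₁⋯b_p}`. -/
def gammaU {A : Type*} [Ring A] [Algebra ℝ A] (Γ : Fin 11 → A) (p : ℕ)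
    (a : Fin p → Fin 11) : A :=
  ∑ b : Fin p → Fin 11, (∏ i, eta (a i) (b i)) • gammaA Γ p b


section Clifford

variable {A : Type*} [Ring A] {Γ : Fin 11 → A}

/-- The ordered product of the generators with index in `w`. -/
def cliffordMonomial (Γ : Fin 11 → A) (w : Finset (Fin 11)) : A :=
  ((List.finRange 11).map fun i => if i ∈ w then Γ i else 1).prod

@[simp]
theorem cliffordMonomial_empty : cliffordMonomial Γ ∅ = 1 := by
  simp [cliffordMonomial]

variable [Algebra ℝ A]

theorem eta_self_mul_self (a : Fin 11) : eta a a * eta a a = 1 := by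
  rw [eta, if_pos rfl]
  split_ifs <;> norm_num

theorem CliffordRel.mul_self (h : CliffordRel Γ) (a : Fin 11) :
    Γ a * Γ a = eta a a • (1 : A) := by
  have h2 := h a a
  rw [← two_smul ℝ, mul_smul] at h2
  exact smul_right_injective A (two_ne_zero : (2 : ℝ) ≠ 0) h2

theorem CliffordRel.anticomm (h : CliffordRel Γ) {a b : Fin 11} (hab : a ≠ b) :
    Γ a * Γ b = -(Γ b * Γ a) := by
  have h2 := h a b
  rw [eta, if_neg hab, mul_zero, zero_smul] at h2
  exact eq_neg_of_add_eq_zero_left h2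

theorem cliffordMonomial_insert (h : CliffordRel Γ) {a : Fin 11} {w : Finset (Fin 11)}
    (ha : a ∉ w) :
    cliffordMonomial Γ (insert a w) = Γ a * cliffordMonomial Γ w ∨
      cliffordMonomial Γ (insert a w) = -(Γ a * cliffordMonomial Γ w) := by
  have key : ∀ l : List (Fin 11), l.Nodup → a ∈ l →
      (l.map fun i => if i ∈ insert a w then Γ i else 1).prod
          = Γ a * (l.map fun i => if i ∈ w then Γ i else 1).prod ∨
      (l.map fun i => if i ∈ insert a w then Γ i else 1).prod
          = -(Γ a * (l.map fun i => if i ∈ w then Γ i else 1).prod) := by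
    intro l
    induction l with
    | nil => simp
    | cons i l ih =>
      intro hl hal
      rw [List.nodup_cons] at hl
      simp only [List.map_cons, List.prod_cons]
      by_cases hia : i = a
      · subst hia
        left
        rw [if_pos (Finset.mem_insert_self _ _), if_neg ha, one_mul]
        congr 2
        refine List.map_congr_left fun j hj => ?_
        have hji : j ≠ i := fun e => hl.1 (e ▸ hj)
        simp [Finset.mem_insert, hji]
      · have hal' : a ∈ l := (List.mem_cons.1 hal).resolve_left (Ne.symm hia)
        have hi : (i ∈ insert a w) = (i ∈ w) := by simp [Finset.mem_insert, hia]
        simp only [hi]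
        rcases ih hl.2 hal' with e | e <;> rw [e] <;> split_ifs
        · right
          rw [← mul_assoc, h.anticomm hia, neg_mul, mul_assoc]
        · left; simp
        · left
          rw [mul_neg, ← mul_assoc, h.anticomm hia, neg_mul, neg_neg, mul_assoc]
        · right; simp
  exact key _ (List.nodup_finRange 11) (List.mem_finRange a)

theorem gamma_mul_cliffordMonomial (h : CliffordRel Γ) (a : Fin 11) (w : Finset (Fin 11)) :
    Γ a * cliffordMonomial Γ w =
      ((-1 : ℝ) ^ (w.card + if a ∈ w then 1 else 0)) • (cliffordMonomial Γ w * Γ a) := by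
  induction w using Finset.induction_on with
  | empty => simp
  | insert b w hb ih =>
    have key : Γ a * (Γ b * cliffordMonomial Γ w) =
        ((-1 : ℝ) ^ ((insert b w).card + if a ∈ insert b w then 1 else 0)) •
          (Γ b * cliffordMonomial Γ w * Γ a) := by
      rw [Finset.card_insert_of_notMem hb]
      by_cases hab : a = b
      · subst hab
        rw [if_neg hb] at ih
        rw [if_pos (Finset.mem_insert_self _ _)]
        conv_lhs => rw [ih]
        rw [mul_smul_comm, mul_assoc]
        congr 1
        ring
      · have hi : (a ∈ insert b w) = (a ∈ w) := by simp [Finset.mem_insert, hab]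
        simp only [hi]
        rw [← mul_assoc, h.anticomm hab, neg_mul, mul_assoc, ih, mul_smul_comm, ← neg_smul,
          mul_assoc]
        congr 1
        ring
    rcases cliffordMonomial_insert h hb with e | e
    · rw [e, key]
    · rw [e, mul_neg, key, neg_mul, smul_neg]

theorem gamma_conj_cliffordMonomial (h : CliffordRel Γ) (a : Fin 11) {w : Finset (Fin 11)}
    (hw : Even w.card) :
    (eta a a • Γ a) * cliffordMonomial Γ w * Γ a =
      (if a ∈ w then (-1 : ℝ) else 1) • cliffordMonomial Γ w := by
  rw [smul_mul_assoc, gamma_mul_cliffordMonomial h, smul_mul_assoc, smul_mul_assoc, mul_assoc,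
    h.mul_self, mul_smul_comm, mul_one, smul_comm, smul_smul (eta a a), eta_self_mul_self, one_smul,
    pow_add, hw.neg_one_pow]
  split_ifs <;> simp

theorem cliffordMonomial_ne_zero [Nontrivial A] (h : CliffordRel Γ) (w : Finset (Fin 11)) :
    cliffordMonomial Γ w ≠ 0 := by
  induction w using Finset.induction_on with
  | empty => simp
  | insert b w hb ih =>
    have key : Γ b * cliffordMonomial Γ w ≠ 0 := by
      intro e
      apply ih
      have := congrArg (fun x => eta b b • (Γ b * x)) e
      simpa [← mul_assoc, h.mul_self, smul_smul, eta_self_mul_self] using this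
    rcases cliffordMonomial_insert h hb with e | e
    · rwa [e]
    · rwa [e, neg_ne_zero]

theorem sum_two_pow_mul_sign_injective :
    Function.Injective fun w : Finset (Fin 11) =>
      ∑ a : Fin 11, (2 : ℝ) ^ (a : ℕ) * (if a ∈ w then (-1 : ℝ) else 1) := by
  have key : ∀ w : Finset (Fin 11),
      ∑ a : Fin 11, (2 : ℝ) ^ (a : ℕ) * (if a ∈ w then (-1 : ℝ) else 1) =
        ∑ a : Fin 11, (2 : ℝ) ^ (a : ℕ) -
          2 * ((∑ i ∈ w.map Fin.valEmbedding, 2 ^ i : ℕ) : ℝ) := by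
    intro w
    have h1 : ((∑ i ∈ w.map Fin.valEmbedding, 2 ^ i : ℕ) : ℝ) =
        ∑ a : Fin 11, if a ∈ w then (2 : ℝ) ^ (a : ℕ) else 0 := by
      simp [Finset.sum_map]
    rw [h1, Finset.mul_sum, ← Finset.sum_sub_distrib]
    refine Finset.sum_congr rfl fun a _ => ?_
    split_ifs <;> ring
  intro w v hwv
  simp only [key] at hwv
  have h2 : (∑ i ∈ w.map Fin.valEmbedding, 2 ^ i : ℕ) = ∑ i ∈ v.map Fin.valEmbedding, 2 ^ i := by
    have := sub_right_injective hwv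
    exact_mod_cast mul_left_cancel₀ (two_ne_zero : (2 : ℝ) ≠ 0) this
  exact Finset.map_injective _ (Finset.geomSum_injective le_rfl h2)

theorem linearIndependent_cliffordMonomial [Nontrivial A] (h : CliffordRel Γ) :
    LinearIndependent ℝ
      fun w : {w : Finset (Fin 11) // Even w.card} => cliffordMonomial Γ w.1 := by
  refine Module.End.eigenvectors_linearIndependent'
    (∑ a : Fin 11, (2 : ℝ) ^ (a : ℕ) •
      (LinearMap.mulLeft ℝ (eta a a • Γ a) ∘ₗ LinearMap.mulRight ℝ (Γ a)))
    (fun w => ∑ a : Fin 11, (2 : ℝ) ^ (a : ℕ) * (if a ∈ w.1 then (-1 : ℝ) else 1))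
    (sum_two_pow_mul_sign_injective.comp Subtype.val_injective) _ fun w => ⟨?_, ?_⟩
  · rw [Module.End.mem_eigenspace_iff]
    simp only [LinearMap.sum_apply, LinearMap.smul_apply, LinearMap.comp_apply,
      LinearMap.mulRight_apply, LinearMap.mulLeft_apply, Finset.sum_smul]
    refine Finset.sum_congr rfl fun a _ => ?_
    rw [← mul_assoc, gamma_conj_cliffordMonomial h a w.2, smul_smul]
  · exact cliffordMonomial_ne_zero h _

end Clifford

theorem card_even_finset : Fintype.card {w : Finset (Fin 11) // Even w.card} = 1024 := by
  rw [Fintype.card_subtype, Finset.card_filter, ← Finset.powerset_univ,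
    Finset.sum_powerset_apply_card fun k => if Even k then 1 else 0]
  decide

theorem exists_sum_cliffordMonomial {Γ : Fin 11 → Matrix (Fin 32) (Fin 32) ℝ}
    (h : CliffordRel Γ) (N : Matrix (Fin 32) (Fin 32) ℝ) :
    ∃ c : Finset (Fin 11) → ℝ, (∀ w, ¬ Even w.card → c w = 0) ∧
      N = ∑ w, c w • cliffordMonomial Γ w := by
  have hspan := (linearIndependent_cliffordMonomial h).span_eq_top_of_card_eq_finrank'
    (by rw [card_even_finset, Module.finrank_matrix]; simp)
  have hN : N ∈ Submodule.span ℝ (Set.range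
      fun w : {w : Finset (Fin 11) // Even w.card} => cliffordMonomial Γ w.1) :=
    hspan ▸ Submodule.mem_top
  obtain ⟨c, hc⟩ := (Submodule.mem_span_range_iff_exists_fun ℝ).1 hN
  refine ⟨fun w => if hw : Even w.card then c ⟨w, hw⟩ else 0, fun w hw => dif_neg hw, ?_⟩
  rw [← hc, ← Finset.sum_filter_of_ne (p := fun w : Finset (Fin 11) => Even w.card),
    Finset.sum_subtype (p := fun w : Finset (Fin 11) => Even w.card) _ (by simp)]
  · exact Finset.sum_congr rfl fun w _ => by simp only [dif_pos w.2]
  · intro w _ hw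
    by_contra hodd
    exact hw (by simp only [dif_neg hodd, zero_smul])

section Majorana

variable {Γ : Fin 11 → Matrix (Fin 32) (Fin 32) ℝ} {ψ : Fin 32 → ℝ}

/-- The antiautomorphism `N ↦ Γ₀⁻¹ Nᵀ Γ₀` which is adjoint to `N` for the spinor pairing. -/
def majoranaAdjoint (Γ : Fin 11 → Matrix (Fin 32) (Fin 32) ℝ)
    (N : Matrix (Fin 32) (Fin 32) ℝ) : Matrix (Fin 32) (Fin 32) ℝ :=
  -(Γ 0 * Nᵀ * Γ 0)

/-- The rank-one matrix `ψ ψ̄`. -/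
def spinorSquare (Γ : Fin 11 → Matrix (Fin 32) (Fin 32) ℝ) (ψ : Fin 32 → ℝ) :
    Matrix (Fin 32) (Fin 32) ℝ :=
  vecMulVec ψ ψ * Γ 0

theorem Majorana.zero_mul_zero (hM : Majorana Γ) : Γ 0 * Γ 0 = -1 := by
  rw [hM.1.mul_self, eta, if_pos rfl, if_pos rfl, neg_one_smul]

theorem Majorana.zero_mul_zero_mul (hM : Majorana Γ) (N : Matrix (Fin 32) (Fin 32) ℝ) :
    Γ 0 * (Γ 0 * N) = -N := by
  rw [← mul_assoc, hM.zero_mul_zero, neg_one_mul]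

theorem Majorana.transpose_zero (hM : Majorana Γ) : (Γ 0)ᵀ = -Γ 0 := by
  rw [hM.2.2 0, hM.zero_mul_zero, neg_one_mul]

theorem majoranaAdjoint_one (hM : Majorana Γ) : majoranaAdjoint Γ 1 = 1 := by
  rw [majoranaAdjoint, transpose_one, mul_one, hM.zero_mul_zero, neg_neg]

theorem majoranaAdjoint_neg (N : Matrix (Fin 32) (Fin 32) ℝ) :
    majoranaAdjoint Γ (-N) = -majoranaAdjoint Γ N := by
  simp [majoranaAdjoint]

theorem majoranaAdjoint_smul (c : ℝ) (N : Matrix (Fin 32) (Fin 32) ℝ) :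
    majoranaAdjoint Γ (c • N) = c • majoranaAdjoint Γ N := by
  simp [majoranaAdjoint]

theorem majoranaAdjoint_sum {ι : Type*} (s : Finset ι)
    (N : ι → Matrix (Fin 32) (Fin 32) ℝ) :
    majoranaAdjoint Γ (∑ i ∈ s, N i) = ∑ i ∈ s, majoranaAdjoint Γ (N i) := by
  simp [majoranaAdjoint, transpose_sum, Finset.mul_sum, Finset.sum_mul]

theorem majoranaAdjoint_mul (hM : Majorana Γ) (N K : Matrix (Fin 32) (Fin 32) ℝ) :
    majoranaAdjoint Γ (N * K) = majoranaAdjoint Γ K * majoranaAdjoint Γ N := by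
  simp only [majoranaAdjoint, transpose_mul, neg_mul, mul_assoc, hM.zero_mul_zero_mul, mul_neg,
    neg_neg]

theorem majoranaAdjoint_gamma (hM : Majorana Γ) (a : Fin 11) :
    majoranaAdjoint Γ (Γ a) = -Γ a := by
  rw [majoranaAdjoint, hM.2.2 a]
  simp only [mul_assoc, hM.zero_mul_zero_mul, hM.zero_mul_zero, mul_neg, neg_mul, mul_one, neg_neg]

theorem majoranaAdjoint_spinorSquare (hM : Majorana Γ) :
    majoranaAdjoint Γ (spinorSquare Γ ψ) = -spinorSquare Γ ψ := by
  simp only [majoranaAdjoint, spinorSquare, transpose_mul, hM.transpose_zero, transpose_vecMulVec,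
    neg_mul, mul_neg, hM.zero_mul_zero_mul, neg_neg]

theorem majoranaAdjoint_cliffordMonomial (hM : Majorana Γ) (w : Finset (Fin 11)) :
    majoranaAdjoint Γ (cliffordMonomial Γ w) =
      ((-1 : ℝ) ^ (w.card * (w.card + 1) / 2)) • cliffordMonomial Γ w := by
  induction w using Finset.induction_on with
  | empty => simp [majoranaAdjoint_one hM]
  | insert b w hb ih =>
    have key : majoranaAdjoint Γ (Γ b * cliffordMonomial Γ w) =
        ((-1 : ℝ) ^ ((insert b w).card * ((insert b w).card + 1) / 2)) •
          (Γ b * cliffordMonomial Γ w) := by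
      have hexp : (w.card + 1) * (w.card + 1 + 1) / 2 =
          w.card * (w.card + 1) / 2 + (w.card + 1) := by
        rw [← Nat.add_mul_div_right _ _ two_pos]
        congr 1
        ring
      have hcomm := gamma_mul_cliffordMonomial hM.1 b w
      rw [if_neg hb, add_zero] at hcomm
      rw [majoranaAdjoint_mul hM, majoranaAdjoint_gamma hM, ih, Finset.card_insert_of_notMem hb,
        hexp, hcomm, smul_smul, mul_neg, smul_mul_assoc, ← neg_smul]
      congr 1
      rw [pow_add, pow_succ, mul_assoc, mul_right_comm, ← pow_add, ← two_mul, pow_mul]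
      simp
    rcases cliffordMonomial_insert hM.1 hb with e | e
    · rw [e, key]
    · rw [e, majoranaAdjoint_neg, key, smul_neg]

theorem pair_smul (c : ℝ) (N : Matrix (Fin 32) (Fin 32) ℝ) :
    pair Γ (c • N) ψ ψ = c * pair Γ N ψ ψ := by
  simp [pair, smul_mulVec]

theorem pair_neg (N : Matrix (Fin 32) (Fin 32) ℝ) :
    pair Γ (-N) ψ ψ = -pair Γ N ψ ψ := by
  simp [pair, neg_mulVec]

theorem pair_zero : pair Γ 0 ψ ψ = 0 := by
  simp [pair]

theorem pair_sum {ι : Type*} (s : Finset ι) (N : ι → Matrix (Fin 32) (Fin 32) ℝ) :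
    pair Γ (∑ i ∈ s, N i) ψ ψ = ∑ i ∈ s, pair Γ (N i) ψ ψ := by
  simp [pair, Finset.mul_sum, sum_mulVec, dotProduct_sum]

theorem pair_mul_pair (N K : Matrix (Fin 32) (Fin 32) ℝ) :
    pair Γ N ψ ψ * pair Γ K ψ ψ = pair Γ (N * spinorSquare Γ ψ * K) ψ ψ := by
  have e : Γ 0 * (N * spinorSquare Γ ψ * K) = (Γ 0 * N) * vecMulVec ψ ψ * (Γ 0 * K) := by
    simp only [spinorSquare, mul_assoc]
  rw [pair, pair, pair, e]
  generalize Γ 0 * N = N'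
  generalize Γ 0 * K = K'
  rw [← mulVec_mulVec, ← mulVec_mulVec, vecMulVec_mulVec]
  simp [mulVec_smul, mul_comm]

theorem pair_majoranaAdjoint (hM : Majorana Γ) (N : Matrix (Fin 32) (Fin 32) ℝ) :
    pair Γ (majoranaAdjoint Γ N) ψ ψ = -pair Γ N ψ ψ := by
  have e : Γ 0 * majoranaAdjoint Γ N = -(Γ 0 * N)ᵀ := by
    rw [majoranaAdjoint, transpose_mul, hM.transpose_zero, mul_assoc, mul_neg,
      hM.zero_mul_zero_mul, neg_neg, mul_neg, neg_neg]
  rw [pair, e, neg_mulVec, dotProduct_neg, mulVec_transpose, dotProduct_comm,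
    ← dotProduct_mulVec, pair]

theorem pair_eq_zero_of_majoranaAdjoint_eq (hM : Majorana Γ) {N : Matrix (Fin 32) (Fin 32) ℝ}
    (hN : majoranaAdjoint Γ N = N) : pair Γ N ψ ψ = 0 := by
  have := pair_majoranaAdjoint (ψ := ψ) hM N
  rw [hN] at this
  linarith

theorem pair_one (hM : Majorana Γ) : pair Γ 1 ψ ψ = 0 :=
  pair_eq_zero_of_majoranaAdjoint_eq hM (majoranaAdjoint_one hM)

theorem exists_spinorSquare_eq_sum (hM : Majorana Γ) (ψ : Fin 32 → ℝ) :
    ∃ c : Finset (Fin 11) → ℝ, (∀ w, c w ≠ 0 → w.card % 4 = 2) ∧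
      spinorSquare Γ ψ = ∑ w, c w • cliffordMonomial Γ w := by
  obtain ⟨c, hc, hsum⟩ := exists_sum_cliffordMonomial hM.1 (spinorSquare Γ ψ)
  refine ⟨fun w => (c w - c w * (-1) ^ (w.card * (w.card + 1) / 2)) / 2, ?_, ?_⟩
  · intro w hw
    by_contra h4
    apply hw
    by_cases heven : Even w.card
    · have h0 : w.card % 4 = 0 := by
        have := Nat.even_iff.1 heven
        omega
      obtain ⟨k, hk⟩ : ∃ k, w.card = 4 * k := ⟨w.card / 4, by omega⟩
      have : w.card * (w.card + 1) / 2 = 2 * (k * (4 * k + 1)) := by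
        rw [hk]
        apply Nat.div_eq_of_eq_mul_left two_pos
        ring
      simp only [this, pow_mul]
      norm_num
    · simp [hc w heven]
  · have h2 : (2 : ℝ) • spinorSquare Γ ψ =
        spinorSquare Γ ψ - majoranaAdjoint Γ (spinorSquare Γ ψ) := by
      rw [majoranaAdjoint_spinorSquare hM, two_smul, sub_neg_eq_add]
    have h3 : spinorSquare Γ ψ - majoranaAdjoint Γ (spinorSquare Γ ψ) =
        ∑ w, (c w - c w * (-1) ^ (w.card * (w.card + 1) / 2)) • cliffordMonomial Γ w := by
      conv_lhs => rw [hsum]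
      rw [majoranaAdjoint_sum, ← Finset.sum_sub_distrib]
      refine Finset.sum_congr rfl fun w _ => ?_
      rw [majoranaAdjoint_smul, majoranaAdjoint_cliffordMonomial hM, smul_smul, ← sub_smul]
    apply smul_right_injective _ (two_ne_zero : (2 : ℝ) ≠ 0)
    simp only
    rw [h2, h3, Finset.smul_sum]
    refine Finset.sum_congr rfl fun w _ => ?_
    rw [smul_smul]
    congr 1
    ring

/-- The sign in `Γ^a Γ_w Γ_a = ± Γ_w` for `w` of even degree. -/
def conjSign (w : Finset (Fin 11)) (a : Fin 11) : ℝ := if a ∈ w then -1 else 1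

theorem conjSign_mul_self (w : Finset (Fin 11)) (a : Fin 11) :
    conjSign w a * conjSign w a = 1 := by
  unfold conjSign
  split_ifs <;> norm_num

theorem sum_conjSign (w : Finset (Fin 11)) : ∑ a, conjSign w a = 11 - 2 * w.card := by
  have : ∀ a, conjSign w a = 1 - 2 * (if a ∈ w then 1 else 0) := by
    intro a
    unfold conjSign
    split_ifs <;> norm_num
  simp [this, Finset.sum_sub_distrib, mul_comm]

/-- Fierz rearrangement: conjugating `ψ ψ̄` by Clifford monomials is diagonal in the
monomial basis. -/
theorem exists_fierz_weights (hM : Majorana Γ) (ψ : Fin 32 → ℝ)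
    (G : Matrix (Fin 32) (Fin 32) ℝ) :
    ∃ d : Finset (Fin 11) → ℝ, (∀ w, d w ≠ 0 → w.card % 4 = 2) ∧
      (∀ w, pair Γ (cliffordMonomial Γ w * G) ψ ψ = 0 → d w = 0) ∧
      ∀ l : List (Fin 11),
        pair Γ (l.map fun a => eta a a • Γ a).prod ψ ψ *
          pair Γ ((l.reverse.map Γ).prod * G) ψ ψ =
        ∑ w, d w * (l.map (conjSign w)).prod := by
  obtain ⟨c, hc, hsum⟩ := exists_spinorSquare_eq_sum hM ψ
  refine ⟨fun w => c w * pair Γ (cliffordMonomial Γ w * G) ψ ψ,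
    fun w hw => hc w (left_ne_zero_of_mul hw), fun w hw => by simp only [hw, mul_zero],
    fun l => ?_⟩
  have key : (l.map fun a => eta a a • Γ a).prod * spinorSquare Γ ψ * (l.reverse.map Γ).prod =
      ∑ w, (c w * (l.map (conjSign w)).prod) • cliffordMonomial Γ w := by
    induction l with
    | nil => simp [hsum]
    | cons a l ih =>
      have e : ((a :: l).map fun a => eta a a • Γ a).prod * spinorSquare Γ ψ *
          ((a :: l).reverse.map Γ).prod = (eta a a • Γ a) *
            ((l.map fun a => eta a a • Γ a).prod * spinorSquare Γ ψ *
              (l.reverse.map Γ).prod) * Γ a := by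
        simp [mul_assoc]
      rw [e, ih, Finset.mul_sum, Finset.sum_mul]
      refine Finset.sum_congr rfl fun w _ => ?_
      by_cases hw : c w = 0
      · simp [hw]
      · have heven : Even w.card := Nat.even_iff.2 (by have := hc w hw; omega)
        rw [mul_smul_comm, smul_mul_assoc, gamma_conj_cliffordMonomial hM.1 a heven, smul_smul,
          List.map_cons, List.prod_cons, conjSign]
        congr 1
        ring
  rw [pair_mul_pair, ← mul_assoc, key, Finset.sum_mul, pair_sum]
  refine Finset.sum_congr rfl fun w _ => ?_
  rw [smul_mul_assoc, pair_smul]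
  ring

theorem pair_three_eq_zero (hM : Majorana Γ) {a b c : Fin 11} (hab : a ≠ b) (hbc : b ≠ c)
    (hac : a ≠ c) : pair Γ (Γ a * Γ b * Γ c) ψ ψ = 0 := by
  apply pair_eq_zero_of_majoranaAdjoint_eq hM
  rw [majoranaAdjoint_mul hM, majoranaAdjoint_mul hM]
  simp only [majoranaAdjoint_gamma hM]
  have e : Γ c * Γ b * Γ a = -(Γ a * Γ b * Γ c) := by
    rw [hM.1.anticomm hbc.symm, neg_mul, mul_assoc, hM.1.anticomm hac.symm, mul_neg, ← mul_assoc,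
      hM.1.anticomm hab.symm, neg_mul, neg_neg]
  rw [neg_mul_neg, neg_mul, ← mul_assoc, e, neg_neg]

theorem sum_mul_conjSign_three {d : Finset (Fin 11) → ℝ}
    (hd : ∀ a b c, a ≠ b → b ≠ c → a ≠ c →
      ∑ w, d w * (conjSign w a * conjSign w b * conjSign w c) = 0) (a b c : Fin 11) :
    ∑ w, d w * (conjSign w a * conjSign w b * conjSign w c) =
      (if a = b then ∑ w, d w * conjSign w c else 0) +
      (if b = c then ∑ w, d w * conjSign w a else 0) +
      (if a = c then ∑ w, d w * conjSign w b else 0) -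
      2 * (if a = b then if b = c then ∑ w, d w * conjSign w a else 0 else 0) := by
  by_cases hab : a = b
  · subst hab
    have h1 : ∀ w, conjSign w a * conjSign w a * conjSign w c = conjSign w c := fun w => by
      rw [conjSign_mul_self, one_mul]
    simp only [h1]
    by_cases hac : a = c
    · subst hac
      simp only [if_true]
      ring
    · simp [hac]
  · by_cases hbc : b = c
    · subst hbc
      have h1 : ∀ w, conjSign w a * conjSign w b * conjSign w b = conjSign w a := fun w => by
        rw [mul_assoc, conjSign_mul_self, mul_one]
      simp [h1, hab]
    · by_cases hac : a = c
      · subst hac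
        have h1 : ∀ w, conjSign w a * conjSign w b * conjSign w a = conjSign w b := fun w => by
          rw [mul_right_comm, conjSign_mul_self, one_mul]
        simp [h1, hab, hbc]
      · simp [hab, hbc, hac, hd a b c hab hbc hac]

/-- Spectral weights of the products `(ψ̄ Γ^{a} ⋯ ψ)(ψ̄ Γ_{a} ⋯ G ψ)` for at most three indices. -/
theorem exists_fierz_weights_three (hM : Majorana Γ) (ψ : Fin 32 → ℝ)
    (G : Matrix (Fin 32) (Fin 32) ℝ) :
    ∃ d : Finset (Fin 11) → ℝ, (∀ w, d w ≠ 0 → w.card % 4 = 2) ∧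
      (∀ w, pair Γ (cliffordMonomial Γ w * G) ψ ψ = 0 → d w = 0) ∧
      (∑ w, d w = 0) ∧
      (∀ a, pair Γ (eta a a • Γ a) ψ ψ * pair Γ (Γ a * G) ψ ψ = ∑ w, d w * conjSign w a) ∧
      (∀ a b, pair Γ ((eta a a • Γ a) * (eta b b • Γ b)) ψ ψ * pair Γ (Γ b * Γ a * G) ψ ψ =
        ∑ w, d w * (conjSign w a * conjSign w b)) ∧
      (∀ a b c, a ≠ b → b ≠ c → a ≠ c →
        ∑ w, d w * (conjSign w a * conjSign w b * conjSign w c) = 0) := by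
  obtain ⟨d, hd4, hd0, hd⟩ := exists_fierz_weights hM ψ G
  refine ⟨d, hd4, hd0, ?_, fun a => ?_, fun a b => ?_, fun a b c hab hbc hac => ?_⟩
  · simpa [pair_one hM] using (hd []).symm
  · simpa using hd [a]
  · simpa using hd [a, b]
  · have h := hd [a, b, c]
    simp only [List.map_cons, List.map_nil, List.prod_cons, List.prod_nil, mul_one,
      smul_mul_smul_comm, pair_smul, ← mul_assoc, pair_three_eq_zero hM hab hbc hac, mul_zero,
      zero_mul] at h
    simpa [mul_assoc] using h.symm

theorem sum_mul_sum_conjSign {ι : Type*} [Fintype ι] (d : Finset (Fin 11) → ℝ) (f : ι → Fin 11) :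
    ∑ w, d w * ∑ i, conjSign w (f i) = ∑ i, ∑ w, d w * conjSign w (f i) := by
  simp only [Finset.mul_sum]
  exact Finset.sum_comm

theorem sum_mul_sum_conjSign_two {ι κ : Type*} [Fintype ι] [Fintype κ]
    (d : Finset (Fin 11) → ℝ) (f : ι → Fin 11) (g : κ → Fin 11) :
    ∑ w, d w * ((∑ i, conjSign w (f i)) * ∑ j, conjSign w (g j)) =
      ∑ i, ∑ j, ∑ w, d w * (conjSign w (f i) * conjSign w (g j)) := by
  have e : ∀ w, d w * ((∑ i, conjSign w (f i)) * ∑ j, conjSign w (g j)) =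
      ∑ i, ∑ j, d w * (conjSign w (f i) * conjSign w (g j)) := fun w => by
    rw [Finset.sum_mul_sum]
    simp only [Finset.mul_sum]
  rw [Finset.sum_congr rfl fun w _ => e w, Finset.sum_comm]
  exact Finset.sum_congr rfl fun i _ => Finset.sum_comm

theorem sum_mul_sum_conjSign_three {ι : Type*} [Fintype ι] (d : Finset (Fin 11) → ℝ)
    (f : ι → Fin 11) :
    ∑ w, d w * ((∑ i, conjSign w (f i)) * (∑ a, conjSign w a) * ∑ c, conjSign w c) =
      ∑ i, ∑ a, ∑ c, ∑ w, d w * (conjSign w (f i) * conjSign w a * conjSign w c) := by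
  have e : ∀ w, d w * ((∑ i, conjSign w (f i)) * (∑ a, conjSign w a) * ∑ c, conjSign w c) =
      ∑ i, ∑ a, ∑ c, d w * (conjSign w (f i) * conjSign w a * conjSign w c) := fun w => by
    rw [Finset.sum_mul_sum, Finset.sum_mul]
    simp only [Finset.sum_mul, Finset.mul_sum]
    exact Finset.sum_congr rfl fun i _ => Finset.sum_comm
  rw [Finset.sum_congr rfl fun w _ => e w, Finset.sum_comm]
  refine Finset.sum_congr rfl fun i _ => ?_
  rw [Finset.sum_comm]
  exact Finset.sum_congr rfl fun a _ => Finset.sum_comm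

theorem card_cases_of_mod_four {w : Finset (Fin 11)} (hw : w.card % 4 = 2) :
    w.card = 2 ∨ w.card = 6 ∨ w.card = 10 := by
  have := Finset.card_le_univ w
  simp only [Fintype.card_fin] at this
  omega

theorem sum_pair_two_eq (hM : Majorana Γ) (ψ : Fin 32 → ℝ) (G : Matrix (Fin 32) (Fin 32) ℝ) :
    ∑ a, ∑ c, pair Γ ((eta a a • Γ a) * (eta c c • Γ c)) ψ ψ * pair Γ (Γ c * Γ a * G) ψ ψ =
      10 * ∑ a, pair Γ (eta a a • Γ a) ψ ψ * pair Γ (Γ a * G) ψ ψ := by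
  obtain ⟨d, hd4, -, h0, h1, h2, h3⟩ := exists_fierz_weights_three hM ψ G
  simp only [h1, h2]
  have hx : ∀ w, d w * ((∑ a, conjSign w a) * (∑ a, conjSign w a) * ∑ a, conjSign w a) +
      3 * (d w * ((∑ a, conjSign w a) * ∑ a, conjSign w a)) -
      61 * (d w * ∑ a, conjSign w a) - 63 * d w = 0 := by
    intro w
    by_cases hw : d w = 0
    · simp [hw]
    · rw [sum_conjSign]
      rcases card_cases_of_mod_four (hd4 w hw) with e | e | e <;> rw [e] <;> push_cast <;> ring
  have hsum := Finset.sum_congr (rfl : (Finset.univ : Finset (Finset (Fin 11))) = _)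
    fun w _ => hx w
  simp only [Finset.sum_sub_distrib, Finset.sum_add_distrib, ← Finset.mul_sum,
    Finset.sum_const_zero, h0] at hsum
  have e1 := sum_mul_sum_conjSign d (id : Fin 11 → Fin 11)
  have e2 := sum_mul_sum_conjSign_two d (id : Fin 11 → Fin 11) (id : Fin 11 → Fin 11)
  have e3 := sum_mul_sum_conjSign_three d (id : Fin 11 → Fin 11)
  simp only [id] at e1 e2 e3
  rw [e1, e2, e3] at hsum
  simp only [sum_mul_conjSign_three h3, Finset.sum_sub_distrib, Finset.sum_add_distrib,
    ← Finset.mul_sum, Finset.sum_ite_eq, Finset.mem_univ, if_true, Finset.sum_const,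
    Finset.card_univ, Fintype.card_fin, Finset.sum_ite_irrel, smul_zero, mul_zero] at hsum
  simp only [nsmul_eq_mul, ← Finset.mul_sum] at hsum
  push_cast at hsum
  linarith

theorem prod_four_eq_cliffordMonomial_or_neg (hM : Majorana Γ) {b : Fin 4 → Fin 11}
    (hb : Function.Injective b) :
    ∃ B : Finset (Fin 11), B.card = 4 ∧ (∀ a, a ∈ B ↔ a ∈ Set.range b) ∧
      (Γ (b 0) * Γ (b 1) * Γ (b 2) * Γ (b 3) = cliffordMonomial Γ B ∨
        Γ (b 0) * Γ (b 1) * Γ (b 2) * Γ (b 3) = -cliffordMonomial Γ B) := by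
  have n3 : b 3 ∉ (∅ : Finset (Fin 11)) := by simp
  have n2 : b 2 ∉ insert (b 3) (∅ : Finset (Fin 11)) := by simp [hb.eq_iff]
  have n1 : b 1 ∉ insert (b 2) (insert (b 3) (∅ : Finset (Fin 11))) := by simp [hb.eq_iff]
  have n0 : b 0 ∉ insert (b 1) (insert (b 2) (insert (b 3) (∅ : Finset (Fin 11)))) := by
    simp [hb.eq_iff]
  refine ⟨insert (b 0) (insert (b 1) (insert (b 2) (insert (b 3) ∅))), ?_, ?_, ?_⟩
  · rw [Finset.card_insert_of_notMem n0, Finset.card_insert_of_notMem n1,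
      Finset.card_insert_of_notMem n2, Finset.card_insert_of_notMem n3, Finset.card_empty]
  · intro a
    simp [Fin.exists_fin_succ, eq_comm]
  · rcases cliffordMonomial_insert hM.1 n0 with e0 | e0 <;>
    rcases cliffordMonomial_insert hM.1 n1 with e1 | e1 <;>
    rcases cliffordMonomial_insert hM.1 n2 with e2 | e2 <;>
    rcases cliffordMonomial_insert hM.1 n3 with e3 | e3 <;>
    rw [e0, e1, e2, e3, cliffordMonomial_empty] <;> simp [mul_assoc]

theorem majoranaAdjoint_prod_four (hM : Majorana Γ) {b : Fin 4 → Fin 11}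
    (hb : Function.Injective b) :
    majoranaAdjoint Γ (Γ (b 0) * Γ (b 1) * Γ (b 2) * Γ (b 3)) =
      Γ (b 0) * Γ (b 1) * Γ (b 2) * Γ (b 3) := by
  obtain ⟨B, hB, -, e | e⟩ := prod_four_eq_cliffordMonomial_or_neg hM hb <;>
  simp [e, majoranaAdjoint_neg, majoranaAdjoint_cliffordMonomial hM, hB,
    show (-1 : ℝ) ^ 10 = 1 by norm_num]

theorem gamma_mul_prod_four (hM : Majorana Γ) {b : Fin 4 → Fin 11}
    (hb : Function.Injective b) {a : Fin 11} (ha : a ∉ Set.range b) :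
    Γ a * (Γ (b 0) * Γ (b 1) * Γ (b 2) * Γ (b 3)) =
      Γ (b 0) * Γ (b 1) * Γ (b 2) * Γ (b 3) * Γ a := by
  obtain ⟨B, hB, hmem, e | e⟩ := prod_four_eq_cliffordMonomial_or_neg hM hb <;>
  simp [e, gamma_mul_cliffordMonomial hM.1, hB, (hmem a).not.2 ha,
    show (-1 : ℝ) ^ 4 = 1 by norm_num]

theorem gamma_mul_prod_four_of_mem (hM : Majorana Γ) {b : Fin 4 → Fin 11}
    (hb : Function.Injective b) {a : Fin 11} (ha : a ∈ Set.range b) :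
    Γ a * (Γ (b 0) * Γ (b 1) * Γ (b 2) * Γ (b 3)) =
      -(Γ (b 0) * Γ (b 1) * Γ (b 2) * Γ (b 3) * Γ a) := by
  obtain ⟨B, hB, hmem, e | e⟩ := prod_four_eq_cliffordMonomial_or_neg hM hb <;>
  simp [e, gamma_mul_cliffordMonomial hM.1, hB, (hmem a).2 ha, pow_succ]

theorem pair_gamma_mul_prod_four_of_mem (hM : Majorana Γ) {b : Fin 4 → Fin 11}
    (hb : Function.Injective b) {a : Fin 11} (ha : a ∈ Set.range b) :
    pair Γ (Γ a * (Γ (b 0) * Γ (b 1) * Γ (b 2) * Γ (b 3))) ψ ψ = 0 := by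
  apply pair_eq_zero_of_majoranaAdjoint_eq hM
  rw [majoranaAdjoint_mul hM, majoranaAdjoint_prod_four hM hb, majoranaAdjoint_gamma hM,
    gamma_mul_prod_four_of_mem hM hb ha, mul_neg]

theorem pair_gamma_mul_gamma_mul_prod_four (hM : Majorana Γ) {b : Fin 4 → Fin 11}
    (hb : Function.Injective b) {a c : Fin 11} (ha : a ∉ Set.range b) (hc : c ∈ Set.range b) :
    pair Γ (Γ a * Γ c * (Γ (b 0) * Γ (b 1) * Γ (b 2) * Γ (b 3))) ψ ψ = 0 := by
  apply pair_eq_zero_of_majoranaAdjoint_eq hM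
  rw [majoranaAdjoint_mul hM, majoranaAdjoint_prod_four hM hb, majoranaAdjoint_mul hM,
    majoranaAdjoint_gamma hM, majoranaAdjoint_gamma hM, neg_mul_neg, mul_assoc (Γ a),
    gamma_mul_prod_four_of_mem hM hb hc, mul_neg, ← mul_assoc (Γ a),
    gamma_mul_prod_four hM hb ha, mul_assoc _ (Γ a),
    hM.1.anticomm (show a ≠ c from fun e => ha (e ▸ hc)), mul_neg, neg_neg]

theorem prod_four_mul_cliffordMonomial (hM : Majorana Γ) (b : Fin 4 → Fin 11)
    {w : Finset (Fin 11)} (hw : Even w.card) :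
    Γ (b 0) * Γ (b 1) * Γ (b 2) * Γ (b 3) * cliffordMonomial Γ w =
      (∏ i, conjSign w (b i)) •
        (cliffordMonomial Γ w * (Γ (b 0) * Γ (b 1) * Γ (b 2) * Γ (b 3))) := by
  have key : ∀ a, Γ a * cliffordMonomial Γ w = conjSign w a • (cliffordMonomial Γ w * Γ a) := by
    intro a
    rw [gamma_mul_cliffordMonomial hM.1, pow_add, hw.neg_one_pow, conjSign]
    split_ifs <;> simp
  have key' : ∀ a N, Γ a * (cliffordMonomial Γ w * N) =
      conjSign w a • (cliffordMonomial Γ w * (Γ a * N)) := by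
    intro a N
    rw [← mul_assoc, key, smul_mul_assoc, mul_assoc]
  simp only [Fin.prod_univ_four, mul_assoc, key, key', mul_smul_comm, smul_smul]
  congr 1
  ring

theorem prod_conjSign_ne_neg_one_of_pair_ne_zero (hM : Majorana Γ) (b : Fin 4 → Fin 11)
    (hb : Function.Injective b) {w : Finset (Fin 11)} (hw : w.card % 4 = 2)
    (h : pair Γ (cliffordMonomial Γ w * (Γ (b 0) * Γ (b 1) * Γ (b 2) * Γ (b 3))) ψ ψ ≠ 0) :
    ∏ i, conjSign w (b i) ≠ -1 := by
  intro hprod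
  apply h
  have heven : Even w.card := Nat.even_iff.2 (by omega)
  apply pair_eq_zero_of_majoranaAdjoint_eq hM
  have hodd : Odd (w.card * (w.card + 1) / 2) := by
    obtain ⟨k, hk⟩ : ∃ k, w.card = 4 * k + 2 := ⟨w.card / 4, by omega⟩
    refine ⟨4 * k * k + 5 * k + 1, ?_⟩
    rw [hk]
    apply Nat.div_eq_of_eq_mul_left two_pos
    ring
  rw [majoranaAdjoint_mul hM, majoranaAdjoint_prod_four hM hb,
    majoranaAdjoint_cliffordMonomial hM, hodd.neg_one_pow, neg_one_smul, mul_neg,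
    prod_four_mul_cliffordMonomial hM b heven, hprod, neg_one_smul, neg_neg]

theorem sum_conjSign_eq_neg_four {b : Fin 4 → Fin 11} (hb : Function.Injective b)
    {w : Finset (Fin 11)} (hw : w.card = 10) (hprod : ∏ i, conjSign w (b i) ≠ -1) :
    ∑ i, conjSign w (b i) = -4 := by
  obtain ⟨e, he⟩ : ∃ e, wᶜ = {e} := by
    rw [← Finset.card_eq_one, Finset.card_compl, hw, Fintype.card_fin]
  have hs : ∀ a, conjSign w a = if a = e then 1 else -1 := by
    intro a
    have : a ∈ w ↔ a ≠ e := by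
      rw [← not_iff_not, ← Finset.mem_compl, he, Finset.mem_singleton, not_not]
    rw [conjSign]
    simp only [this]
    split_ifs <;> simp_all
  by_cases h : ∃ i, b i = e
  · obtain ⟨i, rfl⟩ := h
    exfalso
    apply hprod
    simp only [hs, hb.eq_iff]
    fin_cases i <;> simp [Fin.prod_univ_four]
  · push Not at h
    simp only [hs, h, if_false]
    norm_num

theorem sum_pair_two_prod_four_eq (hM : Majorana Γ) (ψ : Fin 32 → ℝ) {b : Fin 4 → Fin 11}
    (hb : Function.Injective b) :
    ∑ i, ∑ j, pair Γ ((eta (b i) (b i) • Γ (b i)) * (eta (b j) (b j) • Γ (b j))) ψ ψ *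
        pair Γ (Γ (b j) * Γ (b i) * (Γ (b 0) * Γ (b 1) * Γ (b 2) * Γ (b 3))) ψ ψ =
      4 * ∑ a, pair Γ (eta a a • Γ a) ψ ψ *
        pair Γ (Γ a * (Γ (b 0) * Γ (b 1) * Γ (b 2) * Γ (b 3))) ψ ψ := by
  have hten := sum_pair_two_eq hM ψ (Γ (b 0) * Γ (b 1) * Γ (b 2) * Γ (b 3))
  obtain ⟨d, hd4, hd0, h0, h1, h2, h3⟩ :=
    exists_fierz_weights_three hM ψ (Γ (b 0) * Γ (b 1) * Γ (b 2) * Γ (b 3))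
  have hb1 : ∀ i, ∑ w, d w * conjSign w (b i) = 0 := by
    intro i
    rw [← h1, pair_gamma_mul_prod_four_of_mem hM hb ⟨i, rfl⟩, mul_zero]
  have hb2 : ∀ i, ∑ a, ∑ w, d w * (conjSign w (b i) * conjSign w a) =
      ∑ j, ∑ w, d w * (conjSign w (b i) * conjSign w (b j)) := by
    intro i
    refine (Fintype.sum_of_injective b hb _ _ (fun a ha => ?_) fun _ => rfl).symm
    rw [← h2, pair_gamma_mul_gamma_mul_prod_four hM hb ha ⟨i, rfl⟩, mul_zero]
  simp only [h1, h2] at hten ⊢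
  have hx : ∀ w, d w * ((∑ i, conjSign w (b i)) * (∑ a, conjSign w a) * ∑ a, conjSign w a) -
      6 * (d w * ((∑ i, conjSign w (b i)) * ∑ a, conjSign w a)) -
      7 * (d w * ∑ i, conjSign w (b i)) +
      4 * (d w * ((∑ a, conjSign w a) * ∑ a, conjSign w a)) -
      24 * (d w * ∑ a, conjSign w a) - 28 * d w = 0 := by
    intro w
    by_cases hw : d w = 0
    · simp [hw]
    · rw [sum_conjSign]
      rcases card_cases_of_mod_four (hd4 w hw) with e | e | e
      · rw [e]; push_cast; ring
      · rw [e]; push_cast; ring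
      · rw [sum_conjSign_eq_neg_four hb e (prod_conjSign_ne_neg_one_of_pair_ne_zero hM b hb (hd4 w hw)
          (mt (hd0 w) hw)), e]
        push_cast
        ring
  have hsum := Finset.sum_congr (rfl : (Finset.univ : Finset (Finset (Fin 11))) = _)
    fun w _ => hx w
  simp only [Finset.sum_sub_distrib, Finset.sum_add_distrib, ← Finset.mul_sum,
    Finset.sum_const_zero, h0] at hsum
  have e1 := sum_mul_sum_conjSign d (id : Fin 11 → Fin 11)
  have e2 := sum_mul_sum_conjSign_two d (id : Fin 11 → Fin 11) (id : Fin 11 → Fin 11)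
  have e2' := sum_mul_sum_conjSign_two d b (id : Fin 11 → Fin 11)
  simp only [id] at e1 e2 e2'
  rw [e1, e2, e2', sum_mul_sum_conjSign_three, sum_mul_sum_conjSign] at hsum
  simp only [sum_mul_conjSign_three h3, Finset.sum_sub_distrib, Finset.sum_add_distrib,
    ← Finset.mul_sum, Finset.sum_ite_eq, Finset.mem_univ, if_true, Finset.sum_const,
    Finset.card_univ, Fintype.card_fin, Finset.sum_ite_irrel, smul_zero, mul_zero, hb1,
    hb2] at hsum
  simp only [nsmul_eq_mul] at hsum
  push_cast at hsum
  linarith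

end Majorana

section Antisymmetrization

variable {A : Type*} [Ring A] [Algebra ℝ A] {Γ : Fin 11 → A}

theorem sum_sign_smul_comp_eq_zero {V : Type*} [AddCommGroup V] [Module ℝ V] {p : ℕ}
    {a : Fin p → Fin 11} (ha : ¬Function.Injective a) (f : (Fin p → Fin 11) → V) :
    ∑ σ : Equiv.Perm (Fin p), ((Equiv.Perm.sign σ : ℤ) : ℝ) • f (fun i => a (σ i)) = 0 := by
  simp only [Function.Injective, not_forall] at ha
  obtain ⟨i, j, hij, hne⟩ := ha
  have hswap : ∀ k, a (Equiv.swap i j k) = a k := by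
    intro k
    rcases eq_or_ne k i with rfl | hki
    · rw [Equiv.swap_apply_left, hij]
    · rcases eq_or_ne k j with rfl | hkj
      · rw [Equiv.swap_apply_right, hij]
      · rw [Equiv.swap_apply_of_ne_of_ne hki hkj]
  have h := Equiv.sum_comp (Equiv.mulLeft (Equiv.swap i j))
    fun σ : Equiv.Perm (Fin p) => ((Equiv.Perm.sign σ : ℤ) : ℝ) • f (fun i => a (σ i))
  simp only [Equiv.coe_mulLeft, Equiv.Perm.sign_mul, Equiv.Perm.sign_swap hne, Equiv.Perm.mul_apply,
    hswap, neg_mul, one_mul, Units.val_neg, Int.cast_neg, neg_smul, Finset.sum_neg_distrib] at h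
  have h2 := add_eq_zero_iff_neg_eq.2 h
  rw [← two_smul ℝ] at h2
  exact (smul_eq_zero.1 h2).resolve_left two_ne_zero

theorem gammaA_eq_zero {p : ℕ} {a : Fin p → Fin 11} (ha : ¬Function.Injective a) :
    gammaA Γ p a = 0 := by
  rw [gammaA, sum_sign_smul_comp_eq_zero ha fun x => (List.ofFn fun i => Γ (x i)).prod, smul_zero]

theorem prod_ofFn_swap (h : CliffordRel Γ) {p : ℕ} {a : Fin (p + 1) → Fin 11}
    (ha : Function.Injective a) (i : Fin p) :
    (List.ofFn fun j => Γ (a (Equiv.swap i.castSucc i.succ j))).prod =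
      -(List.ofFn fun j => Γ (a j)).prod := by
  induction p with
  | zero => exact i.elim0
  | succ p ih =>
    refine Fin.cases ?_ (fun k => ?_) i
    · have h2 : ∀ j : Fin p, Equiv.swap (0 : Fin (p + 2)) (Fin.succ 0) j.succ.succ = j.succ.succ :=
        fun j => Equiv.swap_apply_of_ne_of_ne (Fin.succ_ne_zero _)
          fun e => Fin.succ_ne_zero _ (Fin.succ_injective _ e)
      have h01 : a 0 ≠ a (Fin.succ 0) := ha.ne (Fin.succ_ne_zero _).symm
      simp only [Fin.castSucc_zero, List.ofFn_succ, List.prod_cons, Equiv.swap_apply_left,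
        Equiv.swap_apply_right, h2, ← mul_assoc]
      rw [h.anticomm h01, neg_mul, neg_neg]
    · have h0 : Equiv.swap k.succ.castSucc k.succ.succ 0 = 0 :=
        Equiv.swap_apply_of_ne_of_ne (by rw [← Fin.succ_castSucc]; exact (Fin.succ_ne_zero _).symm)
          (Fin.succ_ne_zero _).symm
      have hs : ∀ j : Fin (p + 1), Equiv.swap k.succ.castSucc k.succ.succ j.succ =
          (Equiv.swap k.castSucc k.succ j).succ := by
        intro j
        rw [← Fin.succ_castSucc]
        exact ((Fin.succ_injective _).map_swap _ _ _).symm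
      rw [List.ofFn_succ, List.ofFn_succ (f := fun j => Γ (a j)), List.prod_cons, List.prod_cons, h0]
      simp only [hs]
      rw [ih (a := fun j => a j.succ) (ha.comp (Fin.succ_injective _)) k, mul_neg]

theorem prod_ofFn_perm (h : CliffordRel Γ) {p : ℕ} {a : Fin p → Fin 11}
    (ha : Function.Injective a) (σ : Equiv.Perm (Fin p)) :
    (List.ofFn fun j => Γ (a (σ j))).prod =
      ((Equiv.Perm.sign σ : ℤ) : ℝ) • (List.ofFn fun j => Γ (a j)).prod := by
  cases p with
  | zero => simp [Subsingleton.elim σ 1]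
  | succ p =>
    have hσ : σ ∈ Submonoid.closure
        (Set.range fun i : Fin p => Equiv.swap i.castSucc i.succ) := by
      rw [Equiv.Perm.mclosure_swap_castSucc_succ]
      trivial
    induction hσ using Submonoid.closure_induction generalizing a with
    | mem σ hσ =>
      obtain ⟨i, rfl⟩ := hσ
      rw [prod_ofFn_swap h ha, Equiv.Perm.sign_swap (Fin.castSucc_lt_succ).ne]
      simp
    | one => simp
    | mul σ τ _ _ ihσ ihτ =>
      simp only [Equiv.Perm.mul_apply]
      rw [ihτ (a := fun j => a (σ j)) (ha.comp σ.injective), ihσ ha, smul_smul,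
        Equiv.Perm.sign_mul, mul_comm]
      push_cast
      rfl

theorem sign_mul_sign_cast {p : ℕ} (σ : Equiv.Perm (Fin p)) :
    ((Equiv.Perm.sign σ : ℤ) : ℝ) * ((Equiv.Perm.sign σ : ℤ) : ℝ) = 1 := by
  rw [← Int.cast_mul, ← Units.val_mul, Int.units_mul_self, Units.val_one, Int.cast_one]

theorem gammaA_eq_prod (h : CliffordRel Γ) {p : ℕ} {a : Fin p → Fin 11}
    (ha : Function.Injective a) : gammaA Γ p a = (List.ofFn fun j => Γ (a j)).prod := by
  simp only [gammaA, prod_ofFn_perm h ha, smul_smul, sign_mul_sign_cast, one_smul,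
    Finset.sum_const, Finset.card_univ, Fintype.card_perm, Fintype.card_fin]
  rw [← Nat.cast_smul_eq_nsmul ℝ, smul_smul, inv_mul_cancel₀ (by positivity), one_smul]

theorem gammaA_cons_of_mem {p : ℕ} {a : Fin 11} {b : Fin p → Fin 11} (ha : a ∈ Set.range b) :
    gammaA Γ (p + 1) (vecCons a b) = 0 :=
  gammaA_eq_zero fun h => (Fin.cons_injective_iff.1 h).1 ha

theorem gammaA_cons_eq_zero {p : ℕ} (a : Fin 11) {b : Fin p → Fin 11}
    (hb : ¬Function.Injective b) : gammaA Γ (p + 1) (vecCons a b) = 0 :=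
  gammaA_eq_zero fun h => hb (Fin.cons_injective_iff.1 h).2

theorem gammaA_cons_of_notMem (h : CliffordRel Γ) {p : ℕ} {a : Fin 11} {b : Fin p → Fin 11}
    (hb : Function.Injective b) (ha : a ∉ Set.range b) :
    gammaA Γ (p + 1) (vecCons a b) = Γ a * gammaA Γ p b := by
  have hab : Function.Injective (vecCons a b) := Fin.cons_injective_iff.2 ⟨ha, hb⟩
  rw [gammaA_eq_prod h hab, gammaA_eq_prod h hb]
  simp [List.ofFn_succ]

theorem gammaA_one (h : CliffordRel Γ) (a : Fin 11) : gammaA Γ 1 ![a] = Γ a := by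
  rw [gammaA_eq_prod h (Function.injective_of_subsingleton _)]
  simp

theorem gammaA_two_self (a : Fin 11) : gammaA Γ 2 ![a, a] = 0 :=
  gammaA_cons_of_mem (by simp)

theorem gammaA_two (h : CliffordRel Γ) {a c : Fin 11} (hac : a ≠ c) :
    gammaA Γ 2 ![a, c] = Γ a * Γ c := by
  rw [gammaA_cons_of_notMem h (Function.injective_of_subsingleton _) (by simpa using hac),
    gammaA_one h]

theorem gammaA_four (h : CliffordRel Γ) {b : Fin 4 → Fin 11} (hb : Function.Injective b) :
    gammaA Γ 4 b = Γ (b 0) * Γ (b 1) * Γ (b 2) * Γ (b 3) := by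
  rw [gammaA_eq_prod h hb]
  simp [List.ofFn_succ, mul_assoc]

theorem gammaU_eq_smul_gammaA {p : ℕ} (a : Fin p → Fin 11) :
    gammaU Γ p a = (∏ i, eta (a i) (a i)) • gammaA Γ p a := by
  rw [gammaU]
  refine Finset.sum_eq_single a (fun b _ hb => ?_) (by simp)
  obtain ⟨i, hi⟩ := Function.ne_iff.1 hb
  rw [Finset.prod_eq_zero (Finset.mem_univ i) (if_neg hi.symm), zero_smul]

theorem gammaU_one (h : CliffordRel Γ) (a : Fin 11) : gammaU Γ 1 ![a] = eta a a • Γ a := by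
  rw [gammaU_eq_smul_gammaA, gammaA_one h]
  simp

theorem gammaU_two (h : CliffordRel Γ) {a c : Fin 11} (hac : a ≠ c) :
    gammaU Γ 2 ![a, c] = (eta a a • Γ a) * (eta c c • Γ c) := by
  rw [gammaU_eq_smul_gammaA, gammaA_two h hac, smul_mul_smul_comm]
  simp

end Antisymmetrization

section Fierz

variable {Γ : Fin 11 → Matrix (Fin 32) (Fin 32) ℝ} {ψ : Fin 32 → ℝ}

theorem pair_gamma_mul_self (hM : Majorana Γ) (a : Fin 11) :
    pair Γ (Γ a * Γ a) ψ ψ = 0 := by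
  rw [hM.1.mul_self, pair_smul, pair_one hM, mul_zero]

theorem pair_gammaA_two (hM : Majorana Γ) (a c : Fin 11) :
    pair Γ (gammaA Γ 2 ![a, c]) ψ ψ = pair Γ (Γ a * Γ c) ψ ψ := by
  rcases eq_or_ne a c with rfl | hac
  · rw [gammaA_two_self, pair_zero, pair_gamma_mul_self hM]
  · rw [gammaA_two hM.1 hac]

theorem pair_gammaU_two (hM : Majorana Γ) (a c : Fin 11) :
    pair Γ (gammaU Γ 2 ![a, c]) ψ ψ = pair Γ ((eta a a • Γ a) * (eta c c • Γ c)) ψ ψ := by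
  rcases eq_or_ne a c with rfl | hac
  · rw [gammaU_eq_smul_gammaA, gammaA_two_self, smul_zero, pair_zero, smul_mul_smul_comm, pair_smul,
      pair_gamma_mul_self hM, mul_zero]
  · rw [gammaU_two hM.1 hac]

theorem pair_two_mul_pair_three (hM : Majorana Γ) (ψ : Fin 32 → ℝ) (a b c : Fin 11) :
    pair Γ ((eta a a • Γ a) * (eta c c • Γ c)) ψ ψ * pair Γ (Γ c * Γ a * Γ b) ψ ψ =
      -((if a = b then pair Γ (eta c c • Γ c) ψ ψ * pair Γ (Γ c * Γ b) ψ ψ else 0) +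
        (if c = b then pair Γ (eta a a • Γ a) ψ ψ * pair Γ (Γ a * Γ b) ψ ψ else 0)) := by
  have h0 := pair_gamma_mul_self (ψ := ψ) hM b
  simp only [smul_mul_smul_comm, pair_smul]
  by_cases hab : a = b
  · subst hab
    by_cases hcb : c = a
    · subst hcb
      simp [h0]
    · rw [if_pos rfl, if_neg hcb, mul_assoc (Γ c), hM.1.mul_self, mul_smul_comm, mul_one, pair_smul,
        hM.1.anticomm (Ne.symm hcb), pair_neg]
      linear_combination (-(eta c c * pair Γ (Γ c * Γ a) ψ ψ * pair Γ (Γ c) ψ ψ)) *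
        eta_self_mul_self a
  · by_cases hcb : c = b
    · subst hcb
      rw [if_neg hab, if_pos rfl, mul_assoc (Γ c), hM.1.anticomm hab, mul_neg, ← mul_assoc,
        hM.1.mul_self, smul_mul_assoc, one_mul, pair_neg, pair_neg, pair_smul,
        hM.1.anticomm (Ne.symm hab), pair_neg]
      linear_combination (-(eta a a) * pair Γ (Γ a * Γ c) ψ ψ * pair Γ (Γ a) ψ ψ) *
        eta_self_mul_self c
    · rw [if_neg hab, if_neg hcb]
      rcases eq_or_ne c a with rfl | hca
      · rw [pair_gamma_mul_self hM]
        simp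
      · rw [pair_three_eq_zero hM hca hab hcb]
        simp

theorem sum_pair_gamma_mul_gamma (hM : Majorana Γ) (ψ : Fin 32 → ℝ) (b : Fin 11) :
    ∑ a, pair Γ (eta a a • Γ a) ψ ψ * pair Γ (Γ a * Γ b) ψ ψ = 0 := by
  have h := sum_pair_two_eq hM ψ (Γ b)
  simp only [pair_two_mul_pair_three hM, Finset.sum_neg_distrib, Finset.sum_add_distrib,
    Finset.sum_ite_irrel, Finset.sum_const_zero, Finset.sum_ite_eq', Finset.mem_univ,
    if_true] at h
  linarith

theorem sum_perm_four {M : Type*} [AddCommMonoid M] (h : Fin 4 → Fin 4 → M)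
    (h0 : ∀ i, h i i = 0) :
    ∑ σ : Equiv.Perm (Fin 4), h (σ 0) (σ 1) = 2 • ∑ i, ∑ j, h i j := by
  have hcard : ∀ i j : Fin 4, i ≠ j →
      (Finset.univ.filter fun σ : Equiv.Perm (Fin 4) => (σ 0, σ 1) = (i, j)).card = 2 := by
    decide
  rw [← Finset.sum_fiberwise' Finset.univ (fun σ : Equiv.Perm (Fin 4) => (σ 0, σ 1))
    fun x => h x.1 x.2, ← Fintype.sum_prod_type', Finset.smul_sum]
  refine Finset.sum_congr rfl fun x _ => ?_
  rw [Finset.sum_const]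
  by_cases hx : x.1 = x.2
  · rw [hx, h0, smul_zero, smul_zero]
  · rw [hcard x.1 x.2 hx]

theorem sign_mul_pair_two_mul_pair_two (hM : Majorana Γ) (ψ : Fin 32 → ℝ) {b : Fin 4 → Fin 11}
    (hb : Function.Injective b) (σ : Equiv.Perm (Fin 4)) :
    ((Equiv.Perm.sign σ : ℤ) : ℝ) *
        (pair Γ (Γ (b (σ 0)) * Γ (b (σ 1))) ψ ψ * pair Γ (Γ (b (σ 2)) * Γ (b (σ 3))) ψ ψ) =
      pair Γ ((eta (b (σ 0)) (b (σ 0)) • Γ (b (σ 0))) * (eta (b (σ 1)) (b (σ 1)) • Γ (b (σ 1)))) ψ ψ *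
        pair Γ (Γ (b (σ 1)) * Γ (b (σ 0)) * (Γ (b 0) * Γ (b 1) * Γ (b 2) * Γ (b 3))) ψ ψ := by
  have hG : Γ (b 0) * Γ (b 1) * Γ (b 2) * Γ (b 3) = ((Equiv.Perm.sign σ : ℤ) : ℝ) •
      (Γ (b (σ 0)) * (Γ (b (σ 1)) * (Γ (b (σ 2)) * Γ (b (σ 3))))) := by
    have h := prod_ofFn_perm hM.1 hb σ
    rw [← gammaA_eq_prod hM.1 hb, gammaA_four hM.1 hb] at h
    have h' : (List.ofFn fun j => Γ (b (σ j))).prod =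
        Γ (b (σ 0)) * (Γ (b (σ 1)) * (Γ (b (σ 2)) * Γ (b (σ 3)))) := by
      simp [List.ofFn_succ]
    rw [← h', h, smul_smul, sign_mul_sign_cast, one_smul]
  have hsq : ∀ a N, Γ a * (Γ a * N) = eta a a • N := fun a N => by
    rw [← mul_assoc, hM.1.mul_self, smul_mul_assoc, one_mul]
  rw [hG, smul_mul_smul_comm]
  simp only [mul_smul_comm, mul_assoc, hsq, pair_smul]
  linear_combination (-((Equiv.Perm.sign σ : ℤ) : ℝ) * pair Γ (Γ (b (σ 0)) * Γ (b (σ 1))) ψ ψ *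
    pair Γ (Γ (b (σ 2)) * Γ (b (σ 3))) ψ ψ) * (eta (b (σ 1)) (b (σ 1)) * eta (b (σ 1)) (b (σ 1)) *
      eta_self_mul_self (b (σ 0)) + eta_self_mul_self (b (σ 1)))

theorem pair_two_self_mul_eq_zero (hM : Majorana Γ) (a : Fin 11) (x : ℝ) :
    pair Γ ((eta a a • Γ a) * (eta a a • Γ a)) ψ ψ * x = 0 := by
  rw [smul_mul_smul_comm, pair_smul, pair_gamma_mul_self hM, mul_zero, zero_mul]

theorem sum_sign_mul_pair_two_mul_pair_two (hM : Majorana Γ) (ψ : Fin 32 → ℝ)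
    {b : Fin 4 → Fin 11} (hb : Function.Injective b) :
    ∑ σ : Equiv.Perm (Fin 4), ((Equiv.Perm.sign σ : ℤ) : ℝ) *
        (pair Γ (Γ (b (σ 0)) * Γ (b (σ 1))) ψ ψ * pair Γ (Γ (b (σ 2)) * Γ (b (σ 3))) ψ ψ) =
      8 * ∑ a, pair Γ (eta a a • Γ a) ψ ψ *
        pair Γ (Γ a * (Γ (b 0) * Γ (b 1) * Γ (b 2) * Γ (b 3))) ψ ψ := by
  simp only [sign_mul_pair_two_mul_pair_two hM ψ hb]
  rw [sum_perm_four (fun i j =>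
      pair Γ ((eta (b i) (b i) • Γ (b i)) * (eta (b j) (b j) • Γ (b j))) ψ ψ *
        pair Γ (Γ (b j) * Γ (b i) * (Γ (b 0) * Γ (b 1) * Γ (b 2) * Γ (b 3))) ψ ψ)
    fun i => pair_two_self_mul_eq_zero hM _ _, sum_pair_two_prod_four_eq hM ψ hb, nsmul_eq_mul]
  push_cast
  ring

theorem pair_gammaA_five (hM : Majorana Γ) {b : Fin 4 → Fin 11} (hb : Function.Injective b)
    (a : Fin 11) : pair Γ (gammaA Γ 5 (vecCons a b)) ψ ψ =
      pair Γ (Γ a * (Γ (b 0) * Γ (b 1) * Γ (b 2) * Γ (b 3))) ψ ψ := by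
  by_cases ha : a ∈ Set.range b
  · rw [gammaA_cons_of_mem ha, pair_zero, pair_gamma_mul_prod_four_of_mem hM hb ha]
  · rw [gammaA_cons_of_notMem hM.1 hb ha, gammaA_four hM.1 hb]

open Classical in
theorem pair_gammaU_two_mul_pair_gammaA_six (hM : Majorana Γ) (ψ : Fin 32 → ℝ)
    {b : Fin 4 → Fin 11} (hb : Function.Injective b) (a c : Fin 11) :
    pair Γ (gammaU Γ 2 ![a, c]) ψ ψ * pair Γ (gammaA Γ 6 (vecCons a (vecCons c b))) ψ ψ =
      (if a ∈ Set.range b then if c ∈ Set.range b then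
        pair Γ ((eta a a • Γ a) * (eta c c • Γ c)) ψ ψ *
          pair Γ (Γ c * Γ a * (Γ (b 0) * Γ (b 1) * Γ (b 2) * Γ (b 3))) ψ ψ else 0 else 0) -
      pair Γ ((eta a a • Γ a) * (eta c c • Γ c)) ψ ψ *
          pair Γ (Γ c * Γ a * (Γ (b 0) * Γ (b 1) * Γ (b 2) * Γ (b 3))) ψ ψ := by
  rw [pair_gammaU_two hM]
  rcases eq_or_ne a c with rfl | hac
  · simp only [pair_two_self_mul_eq_zero hM, ite_self, sub_zero]
  by_cases hc : c ∈ Set.range b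
  · have hcb : ¬Function.Injective (vecCons c b) := fun h => (Fin.cons_injective_iff.1 h).1 hc
    rw [gammaA_cons_eq_zero a hcb, pair_zero, mul_zero]
    by_cases ha : a ∈ Set.range b
    · rw [if_pos ha, if_pos hc, sub_self]
    · rw [if_neg ha, hM.1.anticomm hac.symm, neg_mul, pair_neg,
        pair_gamma_mul_gamma_mul_prod_four hM hb ha hc]
      simp
  · by_cases ha : a ∈ Set.range b
    · have ha' : a ∈ Set.range (vecCons c b) := by
        obtain ⟨i, rfl⟩ := ha
        exact ⟨i.succ, rfl⟩
      rw [gammaA_cons_of_mem ha', if_pos ha, if_neg hc,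
        pair_gamma_mul_gamma_mul_prod_four hM hb hc ha, pair_zero]
      simp
    · have hinj : Function.Injective (vecCons c b) := Fin.cons_injective_iff.2 ⟨hc, hb⟩
      have ha' : a ∉ Set.range (vecCons c b) := by
        rintro ⟨i, hi⟩
        refine Fin.cases (fun h => hac h.symm) (fun j h => ha ⟨j, h⟩) i hi
      rw [gammaA_cons_of_notMem hM.1 hinj ha', gammaA_cons_of_notMem hM.1 hb hc,
        gammaA_four hM.1 hb, if_neg ha, ← mul_assoc, hM.1.anticomm hac, neg_mul, pair_neg]
      ring

open Classical in
theorem sum_ite_mem_range {ι M : Type*} [Fintype ι] [AddCommMonoid M] {b : ι → Fin 11}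
    (hb : Function.Injective b) (f : Fin 11 → M) :
    ∑ a, (if a ∈ Set.range b then f a else 0) = ∑ i, f (b i) := by
  symm
  refine Fintype.sum_of_injective b hb _ _ (fun a ha => ?_) fun i => ?_
  · rw [if_neg ha]
  · rw [if_pos (Set.mem_range_self i)]

theorem sum_pair_gammaU_two_mul_pair_gammaA_six (hM : Majorana Γ) (ψ : Fin 32 → ℝ)
    {b : Fin 4 → Fin 11} (hb : Function.Injective b) :
    ∑ a, ∑ c,
      pair Γ (gammaU Γ 2 ![a, c]) ψ ψ * pair Γ (gammaA Γ 6 (vecCons a (vecCons c b))) ψ ψ =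
      -6 * ∑ a, pair Γ (eta a a • Γ a) ψ ψ *
        pair Γ (Γ a * (Γ (b 0) * Γ (b 1) * Γ (b 2) * Γ (b 3))) ψ ψ := by
  classical
  simp only [pair_gammaU_two_mul_pair_gammaA_six hM ψ hb, Finset.sum_sub_distrib,
    Finset.sum_ite_irrel, Finset.sum_const_zero, sum_ite_mem_range hb, sum_pair_two_eq hM,
    sum_pair_two_prod_four_eq hM ψ hb]
  ring

end Fierz

/-- The quartic Fierz identities controlling 11d supergravity:
(i)  `Σ_a (ψ̄ Γ_{ab} ψ)(ψ̄ Γ^a ψ) = 0`;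
(ii) `Σ_a (ψ̄ Γ_{a b₁b₂b₃b₄} ψ)(ψ̄ Γ^a ψ)
        = (3/4!) Σ_{σ∈S₄} sgn(σ) (ψ̄ Γ_{b_{σ(1)}b_{σ(2)}} ψ)(ψ̄ Γ_{b_{σ(3)}b_{σ(4)}} ψ)`;
(iii) `Σ_a (ψ̄ Γ_{a b₁b₂b₃b₄} ψ)(ψ̄ Γ^a ψ)
        = −(1/6) Σ_{a₁a₂} (ψ̄ Γ^{a₁a₂} ψ)(ψ̄ Γ_{a₁a₂ b₁b₂b₃b₄} ψ)`. -/
theorem quartic_fierz_identities (Γ : Fin 11 → Matrix (Fin 32) (Fin 32) ℝ)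
    (hM : Majorana Γ) (ψ : Fin 32 → ℝ) (b : Fin 11) (bb : Fin 4 → Fin 11) :
    ((∑ a : Fin 11,
        pair Γ (gammaA Γ 2 ![a, b]) ψ ψ * pair Γ (gammaU Γ 1 ![a]) ψ ψ) = 0) ∧
    ((∑ a : Fin 11,
        pair Γ (gammaA Γ 5 ![a, bb 0, bb 1, bb 2, bb 3]) ψ ψ
          * pair Γ (gammaU Γ 1 ![a]) ψ ψ)
      = (3 / (Nat.factorial 4 : ℝ)) *
          ∑ σ : Equiv.Perm (Fin 4), ((Equiv.Perm.sign σ : ℤ) : ℝ) *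
            (pair Γ (gammaA Γ 2 ![bb (σ 0), bb (σ 1)]) ψ ψ
              * pair Γ (gammaA Γ 2 ![bb (σ 2), bb (σ 3)]) ψ ψ)) ∧
    ((∑ a : Fin 11,
        pair Γ (gammaA Γ 5 ![a, bb 0, bb 1, bb 2, bb 3]) ψ ψ
          * pair Γ (gammaU Γ 1 ![a]) ψ ψ)
      = -(1 / 6) * ∑ a₁ : Fin 11, ∑ a₂ : Fin 11,
          pair Γ (gammaU Γ 2 ![a₁, a₂]) ψ ψ
            * pair Γ (gammaA Γ 6 ![a₁, a₂, bb 0, bb 1, bb 2, bb 3]) ψ ψ) := by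
  have hvec : ![bb 0, bb 1, bb 2, bb 3] = bb := by
    ext i
    fin_cases i <;> rfl
  simp only [hvec, gammaU_one hM.1, pair_gammaA_two hM]
  refine ⟨?_, ?_⟩
  · rw [← sum_pair_gamma_mul_gamma hM ψ b]
    exact Finset.sum_congr rfl fun a _ => mul_comm _ _
  by_cases hb : Function.Injective bb
  · simp only [pair_gammaA_five hM hb, sum_sign_mul_pair_two_mul_pair_two hM ψ hb,
      sum_pair_gammaU_two_mul_pair_gammaA_six hM ψ hb, Nat.factorial]
    simp only [mul_comm (pair Γ (Γ _ * (Γ (bb 0) * Γ (bb 1) * Γ (bb 2) * Γ (bb 3))) ψ ψ)]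
    constructor <;> push_cast <;> ring
  · have h6 : ∀ a c : Fin 11, gammaA Γ 6 (vecCons a (vecCons c bb)) = 0 := fun a c =>
      gammaA_cons_eq_zero a fun h => hb (Fin.cons_injective_iff.1 h).2
    have h4 := sum_sign_smul_comp_eq_zero hb fun x : Fin 4 → Fin 11 =>
      pair Γ (Γ (x 0) * Γ (x 1)) ψ ψ * pair Γ (Γ (x 2) * Γ (x 3)) ψ ψ
    simp only [smul_eq_mul] at h4
    simp [gammaA_cons_eq_zero _ hb, h6, h4, pair_zero]

end
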